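/- The questions x₁ = e[xx,10] + e[xx,11] ('x-measurement on the first subsystem yields 1') and y₁ = e[yx,10] + e[yx,11] ('y-measurement on the first subsystem yields 1') belong to L but are not compatible in L: there do not exist f, g, h ∈ L with f(P) + g(P) + h(P) ≤ 1 for all P ∈ S such that x₁ = f + g and y₁ = g + h. In particular the subposet of L generated by x₁ and y₁ is not a Boolean algebra. -/

import Mathlib

namespace BoxWorld

/-- A (2,2)-box assignment: `P a b α β` stands for `P(αβ|ab)`, where the measurement
settings are `a, b ∈ Fin 2` (with `x = 0`, `y = 1`) and the outcomes are `α, β ∈ Fin 2`. -/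
abbrev Box : Type := Fin 2 → Fin 2 → Fin 2 → Fin 2 → ℝ

/-- (P1) positivity, (P2) normalization, (P3) non-signalling. -/
def IsState (P : Box) : Prop :=
  (∀ a b α β, 0 ≤ P a b α β) ∧
  (∀ a b, ∑ α : Fin 2, ∑ β : Fin 2, P a b α β = 1) ∧
  (∀ a b b' α, ∑ β : Fin 2, P a b α β = ∑ β : Fin 2, P a b' α β) ∧
  (∀ a a' b β, ∑ α : Fin 2, P a b α β = ∑ α : Fin 2, P a' b α β)

/-- The set `S` of (2,2)-box states, as a subtype. -/
abbrev State : Type := {P : Box // IsState P}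

/-- The elementary question `e[ab, αβ]`, as a functional on states. -/
def elem (a b α β : Fin 2) : State → ℝ := fun P => P.1 a b α β

abbrev Idx : Type := Fin 2 × Fin 2 × Fin 2 × Fin 2

def elemI (i : Idx) : State → ℝ := elem i.1 i.2.1 i.2.2.1 i.2.2.2

/-- The logic `L` of the (2,2)-box world: all functionals `f = Σ_{e ∈ A} e`, where `A` is a
set of elementary questions whose pointwise sum is `≤ 1` at every state, together with the
complements `1 - f` of all such functionals. -/
def InLogic (f : State → ℝ) : Prop :=
  (∃ A : Finset Idx, (∀ P : State, ∑ i ∈ A, elemI i P ≤ 1) ∧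
      f = fun P => ∑ i ∈ A, elemI i P) ∨
  (∃ A : Finset Idx, (∀ P : State, ∑ i ∈ A, elemI i P ≤ 1) ∧
      f = fun P => 1 - ∑ i ∈ A, elemI i P)

/-- `x₁ = e[xx,10] ⊕ e[xx,11]`: "the `x`-measurement on the first subsystem yields 1". -/
def x1 : State → ℝ := fun P => P.1 0 0 1 0 + P.1 0 0 1 1

/-- `y₁ = e[yx,10] ⊕ e[yx,11]`: "the `y`-measurement on the first subsystem yields 1". -/
def y1 : State → ℝ := fun P => P.1 1 0 1 0 + P.1 1 0 1 1

theorem InLogic.nonneg {f : State → ℝ} (hf : InLogic f) (P : State) : 0 ≤ f P := by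
  rcases hf with ⟨A, -, rfl⟩ | ⟨A, hA, rfl⟩
  · exact Finset.sum_nonneg fun i _ => P.2.1 _ _ _ _
  · exact sub_nonneg.2 (hA P)

/-- Elements of the logic are affine: they respect equality of midpoints of states. -/
theorem InLogic.add_eq_add {f : State → ℝ} (hf : InLogic f) {P Q R T : State}
    (h : P.1 + Q.1 = R.1 + T.1) : f P + f Q = f R + f T := by
  have key (A : Finset Idx) : ∑ i ∈ A, elemI i P + ∑ i ∈ A, elemI i Q =
      ∑ i ∈ A, elemI i R + ∑ i ∈ A, elemI i T := by
    simp only [← Finset.sum_add_distrib]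
    refine Finset.sum_congr rfl fun i _ => ?_
    exact congrFun (congrFun (congrFun (congrFun h i.1) i.2.1) i.2.2.1) i.2.2.2
  rcases hf with ⟨A, -, rfl⟩ | ⟨A, -, rfl⟩
  · exact key A
  · linarith [key A]

/-- The deterministic state whose first subsystem answers `s a` to the measurement `a`,
and whose second subsystem always answers `0`. -/
def detState (s : Fin 2 → Fin 2) : State :=
  ⟨fun a _ α β => if α = s a ∧ β = 0 then 1 else 0, by
    refine ⟨fun a b α β => ?_, fun a b => ?_, fun a b b' α => rfl, fun a a' b β => ?_⟩
    · dsimp only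
      split_ifs <;> norm_num
    · simp [ite_and]
    · simp [ite_and]⟩

theorem detState_add_detState :
    (detState ![1, 1]).1 + (detState ![0, 0]).1 =
      (detState ![1, 0]).1 + (detState ![0, 1]).1 := by
  funext a b α β
  fin_cases a
  · rfl
  · exact add_comm _ _

theorem x1_detState (s : Fin 2 → Fin 2) : x1 (detState s) = if s 0 = 1 then 1 else 0 := by
  simp [x1, detState, eq_comm]

theorem y1_detState (s : Fin 2 → Fin 2) : y1 (detState s) = if s 1 = 1 then 1 else 0 := by
  simp [y1, detState, eq_comm]

/-- The question "the measurement `a` on the first subsystem yields `1`" belongs to the logic. -/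
theorem inLogic_fst_eq_one (a : Fin 2) :
    InLogic fun P => P.1 a 0 1 0 + P.1 a 0 1 1 := by
  have hsum (P : State) : ∑ i ∈ ({(a, 0, 1, 0), (a, 0, 1, 1)} : Finset Idx), elemI i P =
      P.1 a 0 1 0 + P.1 a 0 1 1 := by
    rw [Finset.sum_pair (by simp)]
    rfl
  refine Or.inl ⟨{(a, 0, 1, 0), (a, 0, 1, 1)}, fun P => ?_, funext fun P => (hsum P).symm⟩
  have h := P.2.2.1 a 0
  simp only [Fin.sum_univ_two] at h
  linarith [hsum P, P.2.1 a 0 0 0, P.2.1 a 0 0 1]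

/-- `x₁` and `y₁` belong to `L` but are not compatible in `L`: there are no
pairwise orthogonal `f, g, h ∈ L` with `x₁ = f ⊕ g` and `y₁ = g ⊕ h`; in particular the
subposet of `L` generated by `x₁` and `y₁` is not a Boolean algebra. -/
theorem x1_y1_not_compatible :
    InLogic x1 ∧ InLogic y1 ∧
    ¬ ∃ f g h : State → ℝ, InLogic f ∧ InLogic g ∧ InLogic h ∧
        (∀ P : State, f P + g P + h P ≤ 1) ∧
        x1 = (fun P => f P + g P) ∧ y1 = (fun P => g P + h P) := by
  refine ⟨inLogic_fst_eq_one 0, inLogic_fst_eq_one 1, ?_⟩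
  rintro ⟨f, g, h, hf, hg, hh, hle, hx, hy⟩
  have hg_add := hg.add_eq_add detState_add_detState
  have hx₁₁ := congrFun hx (detState ![1, 1])
  have hy₁₁ := congrFun hy (detState ![1, 1])
  have hy₁₀ := congrFun hy (detState ![1, 0])
  have hx₀₁ := congrFun hx (detState ![0, 1])
  rw [x1_detState] at hx₁₁ hx₀₁
  rw [y1_detState] at hy₁₁ hy₁₀
  simp only [Matrix.cons_val_zero, Matrix.cons_val_one, if_true, zero_ne_one,
    if_false] at hx₁₁ hy₁₁ hy₁₀ hx₀₁
  linarith [hle (detState ![1, 1]), hg.nonneg (detState ![0, 0]),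
    hh.nonneg (detState ![1, 0]), hf.nonneg (detState ![0, 1])]

end BoxWorld
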